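/- Let p be an odd prime with p ≠ 3 and p ≠ 13. Then, with congruences interpreted in ℤ/pℤ and (3|p) the Legendre symbol: (3|p)·∑_{k=0}^{⌊p/4⌋} C(4k,2k)/(−36)^k ≡ 13^{(p−1)/4} (mod p) if p ≡ 1, 9, −23 (mod 52); ≡ −13^{(p−1)/4} (mod p) if p ≡ −3, 17, 25 (mod 52); ≡ 3·13^{(p−3)/4} (mod p) if p ≡ −1, −9, 23 (mod 52); ≡ −3·13^{(p−3)/4} (mod p) if p ≡ 3, −17, −25 (mod 52); ≡ 0 (mod p) if p ≡ 5, −7, −11, −15, −19, 21 (mod 52); ≡ 2·13^{(p−3)/4} (mod p) if p ≡ −5, 7, 11 (mod 52); and ≡ −2·13^{(p−3)/4} (mod p) if p ≡ 15, 19, −21 (mod 52). -/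

import Mathlib

/-- The sum of three powers of `z` which, for `z` a primitive thirteenth root of unity, is a Gaussian
period of the quartic subfield of the thirteenth cyclotomic field. -/
def quarticPeriod {K : Type*} [Field K] (z : K) (r : ℕ) : K :=
  z ^ r + z ^ (3 * r) + z ^ (9 * r)

theorem quarticPeriod_pow_char {K : Type*} [Field K] (p : ℕ) [Fact p.Prime] [CharP K p]
    {z : K} (hz : z ^ 13 = 1) (r : ℕ) :
    quarticPeriod z r ^ p = quarticPeriod z (r * (p % 13)) := by
  have h (k : ℕ) : (z ^ (k * r)) ^ p = z ^ (k * (r * (p % 13))) := by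
    rw [← pow_mul]
    apply pow_eq_pow_of_modEq _ hz
    rw [mul_assoc]
    exact ((Nat.mod_modEq p 13).symm.mul_left r).mul_left k
  have h1 := h 1
  simp only [one_mul] at h1
  rw [quarticPeriod, add_pow_char _ _ p, add_pow_char _ _ p, h, h, h1, quarticPeriod]

theorem quarticPeriod_eq_mod {K : Type*} [Field K] {z : K} (hz : z ^ 13 = 1) (r : ℕ) :
    quarticPeriod z r = z ^ (r % 13) + z ^ (3 * r % 13) + z ^ (9 * r % 13) := by
  simp only [quarticPeriod, ← pow_eq_pow_mod _ hz]

/-- The quartic Gauss sums modulo 13 are `u ± I * v`; their products, and the action of the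
Frobenius on them. -/
theorem exists_quartic_gauss_periods {K : Type*} [Field K] [IsAlgClosed K] (p : ℕ)
    [Fact p.Prime] [CharP K p] :
    ∃ u v : K, u ^ 2 - v ^ 2 = -3 * (u * v) ∧ u ^ 2 + v ^ 2 = -13 ∧ (u * v) ^ 2 = 13 ∧
      (p % 13 = 1 ∨ p % 13 = 3 ∨ p % 13 = 9 → u ^ p = u ∧ v ^ p = v) ∧
      (p % 13 = 2 ∨ p % 13 = 5 ∨ p % 13 = 6 → u ^ p = v ∧ v ^ p = -u) ∧
      (p % 13 = 4 ∨ p % 13 = 10 ∨ p % 13 = 12 → u ^ p = -u ∧ v ^ p = -v) ∧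
      (p % 13 = 7 ∨ p % 13 = 8 ∨ p % 13 = 11 → u ^ p = -v ∧ v ^ p = u) := by
  have : Fact (Nat.Prime 13) := ⟨by norm_num⟩
  obtain ⟨z, hz⟩ := IsAlgClosed.exists_root (Polynomial.cyclotomic 13 K)
    (by rw [Polynomial.degree_cyclotomic, Nat.totient_prime this.out]; norm_num)
  rw [Polynomial.cyclotomic_prime, Polynomial.IsRoot.def, Polynomial.eval_finsetSum] at hz
  simp only [Polynomial.eval_pow, Polynomial.eval_X,
    Finset.sum_range_succ, Finset.sum_range_zero] at hz
  have hz13 : z ^ 13 = 1 := by linear_combination (z - 1) * hz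
  have h1 : quarticPeriod z 1 = z + z ^ 3 + z ^ 9 := by simp [quarticPeriod_eq_mod hz13]
  have h2 : quarticPeriod z 2 = z ^ 2 + z ^ 6 + z ^ 5 := by simp [quarticPeriod_eq_mod hz13]
  have h4 : quarticPeriod z 4 = z ^ 4 + z ^ 12 + z ^ 10 := by simp [quarticPeriod_eq_mod hz13]
  have h8 : quarticPeriod z 8 = z ^ 8 + z ^ 11 + z ^ 7 := by simp [quarticPeriod_eq_mod hz13]
  refine ⟨quarticPeriod z 1 - quarticPeriod z 4, quarticPeriod z 2 - quarticPeriod z 8,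
    ?_, ?_, ?_, ?_, ?_, ?_, ?_⟩
  · rw [h1, h2, h4, h8]
    linear_combination (z ^ 2 + 2 * z ^ 3 - 2 * z ^ 4 - 2 * z ^ 7 - 2 * z ^ 10 + 2 * z ^ 11
      + z ^ 12) * hz
  · rw [h1, h2, h4, h8]
    linear_combination (13 - 13 * z + z ^ 2 - z ^ 3 + 3 * z ^ 4 - 5 * z ^ 5 + 3 * z ^ 6 - z ^ 7
      + 3 * z ^ 8 - 5 * z ^ 9 + 3 * z ^ 10 - z ^ 11 + z ^ 12) * hz
  · rw [h1, h2, h4, h8]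
    linear_combination (-13 + 13 * z + z ^ 6 - z ^ 7 + 2 * z ^ 8 - 2 * z ^ 9 + 3 * z ^ 10
      - 3 * z ^ 11 - 17 * z ^ 13 + 18 * z ^ 14 - 7 * z ^ 15 + 6 * z ^ 16 - 8 * z ^ 17
      + 13 * z ^ 18 - 8 * z ^ 19 + 5 * z ^ 20 - 8 * z ^ 21 + 13 * z ^ 22 - 8 * z ^ 23
      + 6 * z ^ 24 - 7 * z ^ 25 + 5 * z ^ 26 - 4 * z ^ 27 - 3 * z ^ 29 + 3 * z ^ 30
      - 2 * z ^ 31 + 2 * z ^ 32 - z ^ 33 + z ^ 34) * hz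
  all_goals
    simp only [sub_pow_char (p := p), quarticPeriod_pow_char p hz13]
    rintro (h | h | h) <;> rw [h] <;> constructor <;>
      simp only [quarticPeriod_eq_mod hz13, Nat.reduceMul, Nat.reduceMod] <;> ring

/-- For `p = 4 * q + 1`, the Frobenius eigenvalue of a quartic Gauss sum determines a power of
`3 - 2 * i`. -/
theorem pow_mul_thirteen_pow_of_one_mod_four {K : Type*} [Field K] (p q : ℕ) [Fact p.Prime]
    [CharP K p] (hq : p = 4 * q + 1) (h13 : (13 : K) ≠ 0) {u v : K}
    (h1 : u ^ 2 - v ^ 2 = -3 * (u * v)) (h2 : u ^ 2 + v ^ 2 = -13) (h3 : (u * v) ^ 2 = 13)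
    {i w : K} (hi : i ^ 2 = -1) (hw : u ^ p + i * v ^ p = w * (u + i * v)) :
    (3 - 2 * i) ^ (2 * q) * 13 ^ q = w := by
  have hip : i ^ p = i := by
    rw [hq, pow_succ, pow_mul, show i ^ 4 = 1 by linear_combination (i ^ 2 - 1) * hi, one_pow,
      one_mul]
  have hnorm : (u + i * v) * (u - i * v) = -13 := by linear_combination h2 - v ^ 2 * hi
  have hne : u + i * v ≠ 0 := fun h => h13 (by linear_combination hnorm - (u - i * v) * h)
  have hsq : (u + i * v) ^ 2 = (3 - 2 * i) * -(u * v) := by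
    linear_combination h1 + v ^ 2 * hi
  have hpow : (u + i * v) ^ p = w * (u + i * v) := by
    rw [add_pow_char _ _ p, mul_pow, hip, hw]
  apply mul_right_cancel₀ hne
  rw [← hpow, hq, pow_succ, show 4 * q = 2 * (2 * q) by ring, pow_mul (u + i * v), hsq, mul_pow,
    pow_mul (-(u * v)), neg_sq, h3]

/-- For `p = 4 * q + 3`, the Frobenius maps a quartic Gauss sum to a multiple of its conjugate, and the
factor determines a power of `3 - 2 * i`. -/
theorem pow_mul_thirteen_pow_of_three_mod_four {K : Type*} [Field K] (p q : ℕ) [Fact p.Prime]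
    [CharP K p] (hq : p = 4 * q + 3) (h13 : (13 : K) ≠ 0) {u v : K}
    (h1 : u ^ 2 - v ^ 2 = -3 * (u * v)) (h2 : u ^ 2 + v ^ 2 = -13) (h3 : (u * v) ^ 2 = 13)
    {i w : K} (hi : i ^ 2 = -1) (hw : u ^ p - i * v ^ p = w * (u - i * v)) :
    (3 - 2 * i) ^ (2 * q + 1) * 13 ^ q * 13 = -w * (3 + 2 * i) := by
  have hip : i ^ p = -i := by
    rw [hq, pow_add, pow_mul, show i ^ 4 = 1 by linear_combination (i ^ 2 - 1) * hi, one_pow]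
    linear_combination i * hi
  have hnorm : (u + i * v) * (u - i * v) = -13 := by linear_combination h2 - v ^ 2 * hi
  have hsq : (u + i * v) ^ 2 = (3 - 2 * i) * -(u * v) := by
    linear_combination h1 + v ^ 2 * hi
  have hpow : (u + i * v) ^ (p + 1) = -13 * w := by
    rw [pow_succ, add_pow_char _ _ p, mul_pow, hip]
    linear_combination (u + i * v) * hw + w * hnorm
  rw [hq, show 4 * q + 3 + 1 = 2 * (2 * (q + 1)) by ring, pow_mul, hsq, mul_pow,
    pow_mul (-(u * v)), neg_sq, h3] at hpow
  apply mul_right_cancel₀ h13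
  rw [mul_add 2, pow_succ _ q, show 2 * q + 2 * 1 = 2 * q + 1 + 1 by ring,
    pow_succ (3 - 2 * i)] at hpow
  linear_combination (3 + 2 * i) * hpow + 4 * (3 - 2 * i) ^ (2 * q + 1) * 13 ^ q * 13 * hi

theorem thirteen_pow_mul_self_eq {K : Type*} [Field K] (p n : ℕ) (hn : p = 2 * n + 1)
    {s c : K} (hs0 : s ≠ 0) (hs : s ^ 2 = 13) (hc : s ^ p = c * s) : 13 ^ n = c := by
  apply mul_right_cancel₀ hs0
  rw [← hc, hn, pow_succ, pow_mul, hs]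

/-- With `n = (p - 1) / 2`, the central binomial coefficients agree modulo `p` with
`(-4) ^ j * C(n, j)`. -/
theorem centralBinom_eq_choose_mul_neg_four_pow (p n : ℕ) [Fact p.Prime] (hn : p = 2 * n + 1)
    (j : ℕ) (hj : j ≤ n) :
    (Nat.centralBinom j : ZMod p) = (n.choose j : ZMod p) * (-4) ^ j := by
  induction j with
  | zero => simp
  | succ j ih =>
    have hj0 : ((j + 1 : ℕ) : ZMod p) ≠ 0 := by
      rw [Ne, ZMod.natCast_eq_zero_iff]
      exact Nat.not_dvd_of_pos_of_lt j.succ_pos (by omega)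
    have hc := congrArg (Nat.cast : ℕ → ZMod p) (Nat.succ_mul_centralBinom_succ j)
    have hb := congrArg (Nat.cast : ℕ → ZMod p) (Nat.choose_succ_right_eq n j)
    have hp : (2 * n + 1 : ZMod p) = 0 := by
      have := (ZMod.natCast_eq_zero_iff (2 * n + 1) p).mpr (dvd_of_eq hn)
      exact_mod_cast this
    apply mul_left_cancel₀ hj0
    have ih' := ih (by omega)
    push_cast [Nat.cast_sub (show j ≤ n by omega)] at hc hb ⊢
    rw [ih'] at hc
    linear_combination hc + 4 * (-4) ^ j * hb + 2 * (n.choose j : ZMod p) * (-4) ^ j * hp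

theorem sum_range_two_mul {M : Type*} [AddCommMonoid M] (f : ℕ → M) (m : ℕ) :
    ∑ j ∈ Finset.range (2 * m), f j = ∑ k ∈ Finset.range m, (f (2 * k) + f (2 * k + 1)) := by
  induction m with
  | zero => simp
  | succ m ih =>
    rw [Finset.sum_range_succ, ← ih, mul_add, mul_one, Finset.sum_range_succ,
      Finset.sum_range_succ, add_assoc]

theorem one_add_pow_add_one_sub_pow {R : Type*} [CommRing R] (x : R) (n : ℕ) :
    (1 + x) ^ n + (1 - x) ^ n =
      2 * ∑ k ∈ Finset.range (n / 2 + 1), (n.choose (2 * k) : R) * (x ^ 2) ^ k := by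
  have h (y : R) : (1 + y) ^ n = ∑ j ∈ Finset.range (2 * (n / 2 + 1)), y ^ j * n.choose j := by
    rw [add_comm, add_pow]
    simp only [one_pow, mul_one]
    apply Finset.sum_subset (Finset.range_mono (by omega))
    intro j _ hj
    rw [Nat.choose_eq_zero_of_lt (by simpa using hj)]
    simp
  rw [sub_eq_add_neg, h, h, sum_range_two_mul, sum_range_two_mul, ← Finset.sum_add_distrib,
    Finset.mul_sum]
  refine Finset.sum_congr rfl fun k _ => ?_
  rw [(even_two_mul k).neg_pow, (odd_two_mul_add_one k).neg_pow, ← pow_mul]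
  ring

theorem two_mul_legendreSym_mul_sum {K : Type*} [Field K] (p n : ℕ) [Fact p.Prime]
    [Algebra (ZMod p) K] (hn : p = 2 * n + 1) (hp3 : p ≠ 3) {i : K} (hi : i ^ 2 = -1) :
    2 * algebraMap (ZMod p) K ((legendreSym p 3 : ZMod p) *
        (∑ k ∈ Finset.range (p / 4 + 1),
          (Nat.choose (4 * k) (2 * k) : ZMod p) / (-36 : ZMod p) ^ k)) =
      (3 - 2 * i) ^ n + (3 + 2 * i) ^ n := by
  have hcast (m : ℕ) (hm : ¬ p ∣ m) : (m : ZMod p) ≠ 0 := by rwa [Ne, ZMod.natCast_eq_zero_iff]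
  have hp := Fact.out (p := p.Prime)
  have h2 : (2 : ZMod p) ≠ 0 := by
    exact_mod_cast hcast 2 fun h => by
      have := (Nat.prime_dvd_prime_iff_eq hp Nat.prime_two).mp h
      omega
  have h3 : (3 : ZMod p) ≠ 0 := by
    exact_mod_cast hcast 3 fun h => hp3 ((Nat.prime_dvd_prime_iff_eq hp Nat.prime_three).mp h)
  have h36 : (-36 : ZMod p) ≠ 0 := by
    rw [show (-36 : ZMod p) = -(2 * 2 * 3 * 3) by norm_num]
    simp [h2, h3]
  have h3K : (3 : K) ≠ 0 := by
    rw [← map_ofNat (algebraMap (ZMod p) K)]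
    exact (map_ne_zero _).mpr h3
  have hterm (k : ℕ) (hk : k ∈ Finset.range (n / 2 + 1)) :
      algebraMap (ZMod p) K ((Nat.choose (4 * k) (2 * k) : ZMod p) / (-36 : ZMod p) ^ k) =
        (n.choose (2 * k) : K) * ((2 / 3 * i) ^ 2) ^ k := by
    have hk' : 2 * k ≤ n := by rw [Finset.mem_range] at hk; omega
    have hb := centralBinom_eq_choose_mul_neg_four_pow p n hn (2 * k) hk'
    rw [Nat.centralBinom_eq_two_mul_choose, ← mul_assoc] at hb
    have hx : (2 / 3 * i : K) ^ 2 = algebraMap (ZMod p) K ((-4) ^ 2 / -36) := by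
      have h36K : (-36 : K) ≠ 0 := by
        have h := (map_ne_zero (algebraMap (ZMod p) K)).mpr h36
        rwa [map_neg, map_ofNat] at h
      simp only [map_div₀, map_pow, map_neg, map_ofNat]
      rw [mul_pow, hi, div_pow, eq_div_iff h36K]
      field_simp
      norm_num
    rw [hx, show 4 * k = 2 * 2 * k by ring, hb, pow_mul, mul_div_assoc, ← div_pow, map_mul,
      map_pow, map_natCast]
  have hleg : (legendreSym p 3 : ZMod p) = 3 ^ n := by
    rw [legendreSym.eq_pow, show p / 2 = n by omega]
    norm_num
  rw [hleg, map_mul, map_sum, show p / 4 = n / 2 by omega, Finset.sum_congr rfl hterm,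
    mul_left_comm, ← one_add_pow_add_one_sub_pow, map_pow, map_ofNat, mul_add, ← mul_pow,
    ← mul_pow, add_comm]
  congr 2 <;> field_simp

theorem legendreSym_mul_sum_of_one_mod_four (K : Type*) [Field K] [IsAlgClosed K] (p q : ℕ)
    [Fact p.Prime] [Algebra (ZMod p) K] (hq : p = 4 * q + 1)
    (hp13 : p ≠ 13) :
    let T := (legendreSym p 3 : ZMod p) *
        (∑ k ∈ Finset.range (p / 4 + 1),
          (Nat.choose (4 * k) (2 * k) : ZMod p) / (-36 : ZMod p) ^ k)
    (p % 13 = 1 ∨ p % 13 = 3 ∨ p % 13 = 9 → T = 13 ^ q) ∧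
    (p % 13 = 4 ∨ p % 13 = 10 ∨ p % 13 = 12 → T = -13 ^ q) ∧
    (p % 13 = 2 ∨ p % 13 = 5 ∨ p % 13 = 6 ∨ p % 13 = 7 ∨ p % 13 = 8 ∨ p % 13 = 11 → T = 0) := by
  intro T
  have : CharP K p := charP_of_injective_algebraMap (algebraMap (ZMod p) K).injective p
  have hp := Fact.out (p := p.Prime)
  have hcast (m : ℕ) (hm : m.Prime) (h : p ≠ m) : (m : K) ≠ 0 := by
    rw [Ne, CharP.cast_eq_zero_iff K p]
    exact fun hd => h ((Nat.prime_dvd_prime_iff_eq hp hm).mp hd)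
  have h2 : (2 : K) ≠ 0 := by exact_mod_cast hcast 2 Nat.prime_two (by omega)
  have h13 : (13 : K) ≠ 0 := by exact_mod_cast hcast 13 (by norm_num) hp13
  obtain ⟨i, hi'⟩ := IsAlgClosed.exists_pow_nat_eq (-1 : K) (n := 2) (by norm_num)
  have hi : i ^ 2 = -1 := hi'
  have hni : (-i) ^ 2 = -1 := by rw [neg_sq, hi]
  obtain ⟨u, v, e1, e2, e3, f0, f1, f2, f3⟩ := exists_quartic_gauss_periods (K := K) p
  have hT := two_mul_legendreSym_mul_sum p (2 * q) (by omega) (by omega) hi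
  have hs0 : u * v ≠ 0 := fun h => h13 (by rw [← e3, h]; ring)
  have hX0 : (13 : K) ^ q ≠ 0 := pow_ne_zero _ h13
  change 2 * algebraMap (ZMod p) K T = _ at hT
  have key (w w' c d : K) (hw : u ^ p + i * v ^ p = w * (u + i * v))
      (hw' : u ^ p - i * v ^ p = w' * (u - i * v)) (hc : (u * v) ^ p = c * (u * v))
      (hd : w + w' = 2 * d * c) :
      algebraMap (ZMod p) K T = d * 13 ^ q := by
    have hA := pow_mul_thirteen_pow_of_one_mod_four p q hq h13 e1 e2 e3 hi hw
    have hB := pow_mul_thirteen_pow_of_one_mod_four p q hq h13 e1 e2 e3 (w := w') hni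
      (by linear_combination hw')
    rw [mul_neg, sub_neg_eq_add] at hB
    have hX := thirteen_pow_mul_self_eq p (2 * q) (by omega) hs0 e3 hc
    apply mul_left_cancel₀ h2
    apply mul_right_cancel₀ hX0
    linear_combination 13 ^ q * hT + hA + hB + hd - 2 * d * hX
  have h' : p % 13 = 2 ∨ p % 13 = 5 ∨ p % 13 = 6 ∨ p % 13 = 7 ∨ p % 13 = 8 ∨ p % 13 = 11 →
      (p % 13 = 2 ∨ p % 13 = 5 ∨ p % 13 = 6) ∨ (p % 13 = 7 ∨ p % 13 = 8 ∨ p % 13 = 11) := by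
    omega
  refine ⟨fun h => ?_, fun h => ?_, fun h => ?_⟩ <;>
    apply (algebraMap (ZMod p) K).injective
  · obtain ⟨hu, hv⟩ := f0 h
    rw [map_pow, map_ofNat, ← one_mul (_ ^ q)]
    refine key 1 1 1 _ ?_ ?_ ?_ (by ring) <;> simp only [mul_pow, hu, hv] <;> ring
  · obtain ⟨hu, hv⟩ := f2 h
    rw [map_neg, map_pow, map_ofNat, ← neg_one_mul]
    refine key (-1) (-1) 1 _ ?_ ?_ ?_ (by ring) <;> simp only [mul_pow, hu, hv] <;> ring
  · rw [map_zero, ← zero_mul (13 ^ q)]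
    rcases h' h with h | h
    · obtain ⟨hu, hv⟩ := f1 h
      refine key (-i) i (-1) _ ?_ ?_ ?_ (by ring) <;> simp only [mul_pow, hu, hv]
      · linear_combination v * hi
      · linear_combination v * hi
      · ring
    · obtain ⟨hu, hv⟩ := f3 h
      refine key i (-i) (-1) _ ?_ ?_ ?_ (by ring) <;> simp only [mul_pow, hu, hv]
      · linear_combination -v * hi
      · linear_combination -v * hi
      · ring

theorem legendreSym_mul_sum_of_three_mod_four (K : Type*) [Field K] [IsAlgClosed K] (p q : ℕ)
    [Fact p.Prime] [Algebra (ZMod p) K] (hq : p = 4 * q + 3)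
    (hp3 : p ≠ 3) :
    let T := (legendreSym p 3 : ZMod p) *
        (∑ k ∈ Finset.range (p / 4 + 1),
          (Nat.choose (4 * k) (2 * k) : ZMod p) / (-36 : ZMod p) ^ k)
    (p % 13 = 1 ∨ p % 13 = 3 ∨ p % 13 = 9 → T = -3 * 13 ^ q) ∧
    (p % 13 = 4 ∨ p % 13 = 10 ∨ p % 13 = 12 → T = 3 * 13 ^ q) ∧
    (p % 13 = 2 ∨ p % 13 = 5 ∨ p % 13 = 6 → T = -2 * 13 ^ q) ∧
    (p % 13 = 7 ∨ p % 13 = 8 ∨ p % 13 = 11 → T = 2 * 13 ^ q) := by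
  intro T
  have : CharP K p := charP_of_injective_algebraMap (algebraMap (ZMod p) K).injective p
  have hp := Fact.out (p := p.Prime)
  have hcast (m : ℕ) (hm : m.Prime) (h : p ≠ m) : (m : K) ≠ 0 := by
    rw [Ne, CharP.cast_eq_zero_iff K p]
    exact fun hd => h ((Nat.prime_dvd_prime_iff_eq hp hm).mp hd)
  have h2 : (2 : K) ≠ 0 := by exact_mod_cast hcast 2 Nat.prime_two (by omega)
  have h13 : (13 : K) ≠ 0 := by exact_mod_cast hcast 13 (by norm_num) (by omega)
  obtain ⟨i, hi'⟩ := IsAlgClosed.exists_pow_nat_eq (-1 : K) (n := 2) (by norm_num)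
  have hi : i ^ 2 = -1 := hi'
  have hni : (-i) ^ 2 = -1 := by rw [neg_sq, hi]
  obtain ⟨u, v, e1, e2, e3, f0, f1, f2, f3⟩ := exists_quartic_gauss_periods (K := K) p
  have hT := two_mul_legendreSym_mul_sum p (2 * q + 1) (by omega) hp3 hi
  have hs0 : u * v ≠ 0 := fun h => h13 (by rw [← e3, h]; ring)
  have hX0 : (13 : K) ^ q * 13 ≠ 0 := mul_ne_zero (pow_ne_zero _ h13) h13
  change 2 * algebraMap (ZMod p) K T = _ at hT
  have key (w w' c d : K) (hw : u ^ p - i * v ^ p = w * (u - i * v))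
      (hw' : u ^ p + i * v ^ p = w' * (u + i * v)) (hc : (u * v) ^ p = c * (u * v))
      (hd : -w * (3 + 2 * i) - w' * (3 - 2 * i) = 2 * d * c) :
      algebraMap (ZMod p) K T = d * 13 ^ q := by
    have hA := pow_mul_thirteen_pow_of_three_mod_four p q hq h13 e1 e2 e3 hi hw
    have hB := pow_mul_thirteen_pow_of_three_mod_four p q hq h13 e1 e2 e3 (w := w') hni
      (by linear_combination hw')
    rw [mul_neg, sub_neg_eq_add] at hB
    have hX := thirteen_pow_mul_self_eq p (2 * q + 1) (by omega) hs0 e3 hc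
    apply mul_left_cancel₀ h2
    apply mul_right_cancel₀ hX0
    linear_combination 13 ^ q * 13 * hT + hA + hB + hd - 2 * d * hX
  refine ⟨fun h => ?_, fun h => ?_, fun h => ?_, fun h => ?_⟩ <;>
    apply (algebraMap (ZMod p) K).injective <;>
    simp only [map_neg, map_pow, map_mul, map_ofNat]
  · obtain ⟨hu, hv⟩ := f0 h
    refine key 1 1 1 _ ?_ ?_ ?_ (by ring) <;> simp only [mul_pow, hu, hv] <;> ring
  · obtain ⟨hu, hv⟩ := f2 h
    refine key (-1) (-1) 1 _ ?_ ?_ ?_ (by ring) <;> simp only [mul_pow, hu, hv] <;> ring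
  · obtain ⟨hu, hv⟩ := f1 h
    refine key i (-i) (-1) _ ?_ ?_ ?_ (by linear_combination -4 * hi) <;> simp only [mul_pow, hu, hv]
    · linear_combination v * hi
    · linear_combination v * hi
    · ring
  · obtain ⟨hu, hv⟩ := f3 h
    refine key (-i) i (-1) _ ?_ ?_ ?_ (by linear_combination 4 * hi) <;> simp only [mul_pow, hu, hv]
    · linear_combination -v * hi
    · linear_combination -v * hi
    · ring

theorem stmt7 (p : ℕ) [Fact p.Prime] (hp2 : p ≠ 2) (hp3 : p ≠ 3) (hp13 : p ≠ 13) :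
    ((p % 52 = 1 ∨ p % 52 = 9 ∨ p % 52 = 29 →
      (legendreSym p 3 : ZMod p) *
        (∑ k ∈ Finset.range (p / 4 + 1),
          (Nat.choose (4 * k) (2 * k) : ZMod p) / (-36 : ZMod p) ^ k)
        = 13 ^ ((p - 1) / 4)) ∧
    (p % 52 = 49 ∨ p % 52 = 17 ∨ p % 52 = 25 →
      (legendreSym p 3 : ZMod p) *
        (∑ k ∈ Finset.range (p / 4 + 1),
          (Nat.choose (4 * k) (2 * k) : ZMod p) / (-36 : ZMod p) ^ k)
        = -13 ^ ((p - 1) / 4)) ∧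
    (p % 52 = 51 ∨ p % 52 = 43 ∨ p % 52 = 23 →
      (legendreSym p 3 : ZMod p) *
        (∑ k ∈ Finset.range (p / 4 + 1),
          (Nat.choose (4 * k) (2 * k) : ZMod p) / (-36 : ZMod p) ^ k)
        = 3 * 13 ^ ((p - 3) / 4)) ∧
    (p % 52 = 3 ∨ p % 52 = 35 ∨ p % 52 = 27 →
      (legendreSym p 3 : ZMod p) *
        (∑ k ∈ Finset.range (p / 4 + 1),
          (Nat.choose (4 * k) (2 * k) : ZMod p) / (-36 : ZMod p) ^ k)
        = -3 * 13 ^ ((p - 3) / 4)) ∧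
    (p % 52 = 5 ∨ p % 52 = 45 ∨ p % 52 = 41 ∨ p % 52 = 37 ∨ p % 52 = 33 ∨ p % 52 = 21 →
      (legendreSym p 3 : ZMod p) *
        (∑ k ∈ Finset.range (p / 4 + 1),
          (Nat.choose (4 * k) (2 * k) : ZMod p) / (-36 : ZMod p) ^ k) = 0) ∧
    (p % 52 = 47 ∨ p % 52 = 7 ∨ p % 52 = 11 →
      (legendreSym p 3 : ZMod p) *
        (∑ k ∈ Finset.range (p / 4 + 1),
          (Nat.choose (4 * k) (2 * k) : ZMod p) / (-36 : ZMod p) ^ k)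
        = 2 * 13 ^ ((p - 3) / 4)) ∧
    (p % 52 = 15 ∨ p % 52 = 19 ∨ p % 52 = 31 →
      (legendreSym p 3 : ZMod p) *
        (∑ k ∈ Finset.range (p / 4 + 1),
          (Nat.choose (4 * k) (2 * k) : ZMod p) / (-36 : ZMod p) ^ k)
        = -2 * 13 ^ ((p - 3) / 4))) := by
  have hmod : p % 4 = 1 ∨ p % 4 = 3 := by
    have := (Fact.out (p := p.Prime)).eq_two_or_odd
    omega
  rcases hmod with hmod | hmod
  · obtain ⟨q, hq⟩ : ∃ q, p = 4 * q + 1 := ⟨p / 4, by omega⟩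
    obtain ⟨h0, h2, h13⟩ := legendreSym_mul_sum_of_one_mod_four
      (AlgebraicClosure (ZMod p)) p q hq hp13
    rw [show (p - 1) / 4 = q by omega]
    exact ⟨fun h => h0 (by omega), fun h => h2 (by omega), fun h => by omega, fun h => by omega,
      fun h => h13 (by omega), fun h => by omega, fun h => by omega⟩
  · obtain ⟨q, hq⟩ : ∃ q, p = 4 * q + 3 := ⟨p / 4, by omega⟩
    obtain ⟨h0, h2, h1, h3⟩ := legendreSym_mul_sum_of_three_mod_four
      (AlgebraicClosure (ZMod p)) p q hq hp3
    rw [show (p - 3) / 4 = q by omega]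
    exact ⟨fun h => by omega, fun h => by omega, fun h => h2 (by omega), fun h => h0 (by omega),
      fun h => by omega, fun h => h3 (by omega), fun h => h1 (by omega)⟩
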